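/- arXiv:1607.00367 — 8 statements merged into one kernel-verified Lean document; each statement's English description precedes it below -/
import Mathlib

section
/- Let (𝔤,⟨·,·⟩) be a metric Lie algebra, with Levi-Civita product ∇, and let T𝔤 be its tangent algebra with lifted inner product and Levi-Civita product ∇̃. Then for all x, y ∈ 𝔤: ∇̃_{x^c} y^c = (∇_x y)^c, ∇̃_{x^v} y^v = (∇_x y − ½[x,y])^c, ∇̃_{x^c} y^v = (∇_x y + ½ ad*_y x)^v, and ∇̃_{x^v} y^c = (∇_x y + ½ ad*_x y)^v. -/
/-- Bracket of the tangent Lie algebra `T𝔤 = 𝔤 × 𝔤`: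
`[(x₁,x₂),(y₁,y₂)] = ([x₁,y₁], [x₁,y₂] + [x₂,y₁])`. -/
def tangentBracket {G : Type*} [LieRing G] (p q : G × G) : G × G :=
  (⁅p.1, q.1⁆, ⁅p.1, q.2⁆ + ⁅p.2, q.1⁆)

/-- The lifted inner product on `T𝔤 = 𝔤 × 𝔤`:
`⟨(x₁,x₂),(y₁,y₂)⟩ = ⟨x₁,y₁⟩ + ⟨x₂,y₂⟩`. -/
def tangentInner {G : Type*} [AddCommGroup G] [Module ℝ G]
    (inn : G →ₗ[ℝ] G →ₗ[ℝ] ℝ) (p q : G × G) : ℝ :=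
  inn p.1 q.1 + inn p.2 q.2

theorem eq_of_forall_inner_eq {G : Type*} [AddCommGroup G] [Module ℝ G]
    (inn : G →ₗ[ℝ] G →ₗ[ℝ] ℝ) (hpos : ∀ x : G, x ≠ 0 → 0 < inn x x) {a b : G}
    (h : ∀ z, inn a z = inn b z) : a = b := by
  by_contra hne
  have := hpos (a - b) (sub_ne_zero.mpr hne)
  simp [h] at this

theorem eq_of_forall_tangentInner_eq {G : Type*} [AddCommGroup G] [Module ℝ G]
    (inn : G →ₗ[ℝ] G →ₗ[ℝ] ℝ) (hpos : ∀ x : G, x ≠ 0 → 0 < inn x x) {p q : G × G}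
    (h : ∀ r, tangentInner inn p r = tangentInner inn q r) : p = q :=
  Prod.ext
    (eq_of_forall_inner_eq inn hpos fun z => by simpa [tangentInner] using h (z, 0))
    (eq_of_forall_inner_eq inn hpos fun z => by simpa [tangentInner] using h (0, z))

/-- For a metric Lie algebra `(𝔤, ⟨·,·⟩)` with Levi-Civita product `∇` (characterized by the
Koszul formula), and adjoint operators `ad*`, the Levi-Civita product `∇̃` of the tangent
algebra `T𝔤` (with the lifted inner product, also characterized by the Koszul formula)
satisfies, for all `x y : 𝔤`:
`∇̃_{x^c} y^c = (∇_x y)^c`, `∇̃_{x^v} y^v = (∇_x y − ½[x,y])^c`,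
`∇̃_{x^c} y^v = (∇_x y + ½ ad*_y x)^v`, `∇̃_{x^v} y^c = (∇_x y + ½ ad*_x y)^v`. -/
theorem tangent_leviCivita_formulas
    {G : Type*} [LieRing G] [LieAlgebra ℝ G] [Module.Finite ℝ G]
    (inn : G →ₗ[ℝ] G →ₗ[ℝ] ℝ)
    (hsymm : ∀ x y : G, inn x y = inn y x)
    (hpos : ∀ x : G, x ≠ 0 → 0 < inn x x)
    (astar : G → G → G)
    (hastar : ∀ x y z : G, inn (astar x y) z = inn y ⁅x, z⁆)
    (nabla : G → G → G)
    (hkoszul : ∀ x y z : G,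
      2 * inn (nabla x y) z = inn ⁅x, y⁆ z - inn ⁅y, z⁆ x + inn ⁅z, x⁆ y)
    (tnabla : G × G → G × G → G × G)
    (htkoszul : ∀ p q r : G × G,
      2 * tangentInner inn (tnabla p q) r =
        tangentInner inn (tangentBracket p q) r
          - tangentInner inn (tangentBracket q r) p
          + tangentInner inn (tangentBracket r p) q) :
    ∀ x y : G,
      tnabla (x, 0) (y, 0) = ((nabla x y, 0) : G × G) ∧
      tnabla (0, x) (0, y) = ((nabla x y - (1/2 : ℝ) • ⁅x, y⁆, 0) : G × G) ∧
      tnabla (x, 0) (0, y) = ((0, nabla x y + (1/2 : ℝ) • astar y x) : G × G) ∧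
      tnabla (0, x) (y, 0) = ((0, nabla x y + (1/2 : ℝ) • astar x y) : G × G) := by
  have skew : ∀ a b c : G, inn ⁅a, b⁆ c = -inn ⁅b, a⁆ c := fun a b c => by
    rw [← lie_skew, map_neg, LinearMap.neg_apply]
  intro x y
  refine ⟨?_, ?_, ?_, ?_⟩ <;>
  · refine eq_of_forall_tangentInner_eq inn hpos fun ⟨z, w⟩ => ?_
    refine mul_left_cancel₀ (two_ne_zero (α := ℝ)) ((htkoszul _ _ _).trans ?_)
    simp only [tangentInner, tangentBracket, lie_zero, zero_lie, add_zero, zero_add, map_zero,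
      LinearMap.zero_apply, map_add, map_sub, map_smul, LinearMap.add_apply, LinearMap.sub_apply,
      LinearMap.smul_apply, smul_eq_mul, hastar]
    linarith [hkoszul x y z, hkoszul x y w, skew w x y, skew z x y, hsymm x ⁅y, w⁆,
      hsymm y ⁅x, w⁆]
end

section
/- Let 𝔤 be a finite-dimensional real non-abelian Lie algebra such that for all x, y ∈ 𝔤 the bracket [x,y] lies in the linear span of x and y, and let ⟨·,·⟩ be any inner product on 𝔤. Then there exist an abelian ideal 𝔲 ⊂ 𝔤 of codimension 1 and a vector b ∈ 𝔤 orthogonal to 𝔲 (with respect to ⟨·,·⟩) such that [b,x] = x for every x ∈ 𝔲. -/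
/-- An endomorphism of a vector space that maps every `y` into the span of `y` and a fixed nonzero
vector `x` is a homothety up to a map of rank at most one into the line of `x`. -/
theorem LinearMap.exists_eq_smul_add_smul_of_forall_mem_span_pair
    {K V : Type*} [Field K] [AddCommGroup V] [Module K V] (f : V →ₗ[K] V) {x : V} (hx : x ≠ 0)
    (h : ∀ y, f y ∈ Submodule.span K ({x, y} : Set V)) :
    ∃ (c : K) (φ : V →ₗ[K] K), ∀ y, f y = c • y + φ y • x := by
  have hfx : f x ∈ Submodule.span K {x} := by simpa using h x
  have hle : Submodule.span K {x} ≤ (Submodule.span K {x}).comap f := by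
    rw [Submodule.span_singleton_le_iff_mem]
    exact hfx
  obtain ⟨c, hc⟩ := LinearMap.exists_eq_smul_id_of_forall_notLinearIndependent
    (f := (Submodule.span K {x}).mapQ (Submodule.span K {x}) f hle) (by
      intro v
      induction v using Submodule.Quotient.induction_on with
      | _ y =>
      intro hli
      obtain ⟨a, b, hab⟩ := Submodule.mem_span_pair.1 (h y)
      rw [LinearIndependent.pair_iff] at hli
      have hrel := hli b (-1) (by
        rw [Submodule.mapQ_apply, ← hab]
        have hx0 : (Submodule.Quotient.mk x : V ⧸ Submodule.span K {x}) = 0 :=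
          (Submodule.Quotient.mk_eq_zero _).2 (Submodule.mem_span_singleton_self x)
        simp [hx0])
      exact one_ne_zero (neg_eq_zero.1 hrel.2))
  obtain ⟨g, hg⟩ := (LinearMap.toSpanSingleton K V x).exists_leftInverse_of_injective
    (LinearMap.ker_toSpanSingleton K hx)
  refine ⟨c, g ∘ₗ (f - c • LinearMap.id), fun y ↦ ?_⟩
  have hy : f y - c • y ∈ Submodule.span K {x} := by
    rw [← Submodule.Quotient.eq]
    simpa using LinearMap.congr_fun hc (Submodule.Quotient.mk y)
  obtain ⟨a, ha⟩ := Submodule.mem_span_singleton.1 hy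
  have hgx : g x = 1 := by simpa using LinearMap.congr_fun hg 1
  have hgy : g (f y - c • y) = a := by rw [← ha, map_smul, hgx, smul_eq_mul, mul_one]
  rw [LinearMap.comp_apply, LinearMap.sub_apply, LinearMap.smul_apply, LinearMap.id_apply, hgy, ha,
    add_sub_cancel]

/-- If every bracket `⁅x, y⁆` is a linear combination of `x` and `y`, then the bracket is given by
a single linear form. -/
theorem LieAlgebra.exists_lie_eq_smul_sub_smul_of_forall_mem_span_pair
    {K L : Type*} [Field K] [CharZero K] [LieRing L] [LieAlgebra K L] [Module.Finite K L]
    (h : ∀ x y : L, ⁅x, y⁆ ∈ Submodule.span K ({x, y} : Set L)) :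
    ∃ l : L →ₗ[K] K, ∀ x y : L, ⁅x, y⁆ = l x • y - l y • x := by
  by_cases hn : Module.finrank K L = 1
  · obtain ⟨v, hv⟩ := finrank_le_one_iff.1 hn.le
    refine ⟨0, fun x y ↦ ?_⟩
    obtain ⟨a, rfl⟩ := hv x
    obtain ⟨b, rfl⟩ := hv y
    simp
  have hn' : (Module.finrank K L : K) - 1 ≠ 0 := sub_ne_zero.2 (by exact_mod_cast hn)
  let l : L →ₗ[K] K :=
    ((Module.finrank K L : K) - 1)⁻¹ • (LinearMap.trace K L ∘ₗ (LieAlgebra.ad K L : L →ₗ[K] _))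
  have key : ∀ x : L, x ≠ 0 → ∃ φ : L →ₗ[K] K, ∀ y, ⁅x, y⁆ = l x • y + φ y • x := by
    intro x hx
    obtain ⟨c, φ, hφ⟩ :=
      (LieAlgebra.ad K L x).exists_eq_smul_add_smul_of_forall_mem_span_pair hx (h x)
    have hφx : φ x = -c := by
      have := hφ x
      rw [LieAlgebra.ad_apply, lie_self, ← add_smul, eq_comm, smul_eq_zero_iff_left hx] at this
      exact eq_neg_of_add_eq_zero_right this
    have had : LieAlgebra.ad K L x = c • LinearMap.id + φ.smulRight x := by
      ext y
      simpa using hφ y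
    have hl : l x = c := by
      have htr : LinearMap.trace K L (LieAlgebra.ad K L x) =
          ((Module.finrank K L : K) - 1) * c := by
        rw [had, map_add, map_smul, LinearMap.trace_id, LinearMap.trace_smulRight, hφx]
        simp only [smul_eq_mul]
        ring
      change _⁻¹ * LinearMap.trace K L (LieAlgebra.ad K L x) = c
      rw [htr, inv_mul_cancel_left₀ hn']
    exact ⟨φ, fun y ↦ by rw [hl]; exact hφ y⟩
  refine ⟨l, fun x y ↦ ?_⟩
  by_cases hli : LinearIndependent K ![x, y]
  · obtain ⟨φ, hφ⟩ := key x (hli.ne_zero 0)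
    obtain ⟨ψ, hψ⟩ := key y (hli.ne_zero 1)
    have hsum : (φ y + l y) • x + (l x + ψ x) • y = 0 := by
      calc _ = ⁅x, y⁆ + ⁅y, x⁆ := by rw [hφ, hψ]; module
        _ = 0 := by rw [← lie_skew x y, neg_add_cancel]
    have := (LinearIndependent.pair_iff.1 hli _ _ hsum).1
    rw [hφ, eq_neg_of_add_eq_zero_left this, neg_smul, sub_eq_add_neg]
  · by_cases hx : x = 0
    · simp [hx]
    · rw [LinearIndependent.pair_iff' hx] at hli
      push Not at hli
      obtain ⟨a, rfl⟩ := hli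
      simp only [lie_smul, lie_self, smul_zero, map_smul, smul_eq_mul]
      module


/-- Let `𝔤` be a finite-dimensional real non-abelian Lie algebra such that for all `x y`
the bracket `[x,y]` lies in the span of `x` and `y`, and let `⟨·,·⟩` be any inner product
on `𝔤`.  Then there exist an abelian ideal `𝔲 ⊆ 𝔤` of codimension `1` and a vector `b`
orthogonal to `𝔲` such that `[b,x] = x` for every `x ∈ 𝔲`. -/
theorem special_lie_algebra_structure
    {G : Type*} [LieRing G] [LieAlgebra ℝ G] [Module.Finite ℝ G]
    (inn : G →ₗ[ℝ] G →ₗ[ℝ] ℝ)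
    (hsymm : ∀ x y : G, inn x y = inn y x)
    (hpos : ∀ x : G, x ≠ 0 → 0 < inn x x)
    (hnonab : ∃ x y : G, ⁅x, y⁆ ≠ 0)
    (hspan : ∀ x y : G, ⁅x, y⁆ ∈ Submodule.span ℝ ({x, y} : Set G)) :
    ∃ (u : LieIdeal ℝ G) (b : G),
      (∀ x ∈ u, ∀ y ∈ u, ⁅x, y⁆ = (0 : G)) ∧
      Module.finrank ℝ G = Module.finrank ℝ u + 1 ∧
      (∀ x ∈ u, inn b x = 0) ∧
      (∀ x ∈ u, ⁅b, x⁆ = x) := by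
  obtain ⟨l, hl⟩ := LieAlgebra.exists_lie_eq_smul_sub_smul_of_forall_mem_span_pair hspan
  have hl0 : l ≠ 0 := by
    rintro rfl
    obtain ⟨x, y, hxy⟩ := hnonab
    exact hxy (by simp [hl x y])
  have hinj : Function.Injective inn := by
    refine (injective_iff_map_eq_zero inn).2 fun x hx ↦ ?_
    by_contra hx0
    exact (hpos x hx0).ne' (by simp [hx])
  obtain ⟨w, hw⟩ := (LinearMap.injective_iff_surjective_of_finrank_eq_finrank
    (Subspace.dual_finrank_eq (K := ℝ) (V := G)).symm).1 hinj l
  have hlw : l w ≠ 0 := by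
    rw [← hw]
    refine (hpos w ?_).ne'
    rintro rfl
    exact hl0 (by rw [← hw, map_zero])
  refine ⟨{ LinearMap.ker l with
    lie_mem := fun {x m} (hm : l m = 0) ↦ show l ⁅x, m⁆ = 0 by simp [hl x m, hm] },
    (l w)⁻¹ • w, fun x hx y hy ↦ ?_, (Module.Dual.finrank_ker_add_one_of_ne_zero hl0).symm,
    fun x hx ↦ ?_, fun x hx ↦ ?_⟩
  · have hx' : l x = 0 := hx
    have hy' : l y = 0 := hy
    simp [hl x y, hx', hy']
  · have hx' : l x = 0 := hx
    simp [hw, hx']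
  · have hx' : l x = 0 := hx
    simp [hl _ x, hx', hlw]
end

section
/- Let (𝔤,⟨·,·⟩) be a metric Lie algebra with an abelian ideal 𝔲 of codimension 1 and b ∈ 𝔤 orthogonal to 𝔲 with [b,x] = x for all x ∈ 𝔲, λ = ⟨b,b⟩. Then the curvature tensor R̃ of the tangent algebra T𝔤 satisfies, for all x, y, z ∈ 𝔲: R̃(x^c,y^c)z^c = (1/λ)(⟨x,z⟩ y − ⟨y,z⟩ x)^c; R̃(x^v,y^v)z^v = (1/λ)(⟨x,z⟩ y − ⟨y,z⟩ x)^v; R̃(x^c,y^c)z^v = (1/(4λ))(⟨x,z⟩ y^v − ⟨y,z⟩ x^v); R̃(x^v,y^v)z^c = (1/(4λ))(⟨x,z⟩ y^c − ⟨y,z⟩ x^c); R̃(x^c,y^v)z^v = (1/(4λ))(⟨x,z⟩ y^c − 4⟨y,z⟩ x^c); and R̃(x^c,y^v)z^c = (1/(4λ))(4⟨x,z⟩ y^v − ⟨y,z⟩ x^v). -/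
/-- Curvature tensor `R(x,y)z = ∇ₓ∇_y z − ∇_y∇ₓ z − ∇_{[x,y]} z` of a product `∇`
with respect to a bracket `br`. -/
def curvature {A : Type*} [AddCommGroup A] (br : A → A → A) (nab : A → A → A)
    (x y z : A) : A :=
  nab x (nab y z) - nab y (nab x z) - nab (br x y) z

section TangentLeviCivita

variable {G : Type*} [LieRing G] [LieAlgebra ℝ G]

/-- The Koszul identity characterising the Levi-Civita product of the tangent algebra. -/
def TangentKoszul (inn : G →ₗ[ℝ] G →ₗ[ℝ] ℝ) (tnabla : G × G → G × G → G × G) : Prop :=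
  ∀ p q r : G × G,
    2 * tangentInner inn (tnabla p q) r =
      tangentInner inn (tangentBracket p q) r
        - tangentInner inn (tangentBracket q r) p
        + tangentInner inn (tangentBracket r p) q

/-- Nondegeneracy of the lifted inner product. -/
theorem eq_of_tangentInner_eq {inn : G →ₗ[ℝ] G →ₗ[ℝ] ℝ}
    (hpos : ∀ x : G, x ≠ 0 → 0 < inn x x) {p q : G × G}
    (h : ∀ r, 2 * tangentInner inn p r = 2 * tangentInner inn q r) : p = q := by
  have key : ∀ x y : G, (∀ r, inn x r = inn y r) → x = y := by
    intro x y hxy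
    by_contra hne
    have := hpos (x - y) (sub_ne_zero.mpr hne)
    rw [LinearMap.map_sub₂, hxy, sub_self] at this
    exact this.false
  refine Prod.ext (key _ _ fun r => ?_) (key _ _ fun r => ?_)
  · simpa [tangentInner] using h (r, 0)
  · simpa [tangentInner] using h (0, r)

namespace TangentKoszul

variable {inn : G →ₗ[ℝ] G →ₗ[ℝ] ℝ} {tnabla : G × G → G × G → G × G}

theorem smul_right (hk : TangentKoszul inn tnabla) (hpos : ∀ x : G, x ≠ 0 → 0 < inn x x)
    (c : ℝ) (p q : G × G) : tnabla p (c • q) = c • tnabla p q := by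
  refine eq_of_tangentInner_eq hpos fun r => ?_
  have h := hk p q r
  rw [hk]
  simp only [tangentInner, tangentBracket, Prod.smul_fst, Prod.smul_snd, lie_smul, smul_lie,
    map_add, map_smul, LinearMap.add_apply, LinearMap.smul_apply, smul_eq_mul] at h ⊢
  linear_combination (-c) * h

theorem zero_right (hk : TangentKoszul inn tnabla) (hpos : ∀ x : G, x ≠ 0 → 0 < inn x x)
    (p : G × G) : tnabla p 0 = 0 := by
  simpa using hk.smul_right hpos 0 p 0

theorem zero_left (hk : TangentKoszul inn tnabla) (hpos : ∀ x : G, x ≠ 0 → 0 < inn x x)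
    (q : G × G) : tnabla 0 q = 0 := by
  refine eq_of_tangentInner_eq hpos fun r => ?_
  rw [hk]
  simp [tangentInner, tangentBracket]

end TangentKoszul

/-- A codimension one ideal together with a nonzero vector orthogonal to it spans the algebra. -/
theorem exists_smul_add_of_codim_one [Module.Finite ℝ G] {inn : G →ₗ[ℝ] G →ₗ[ℝ] ℝ}
    (hpos : ∀ x : G, x ≠ 0 → 0 < inn x x) {u : LieIdeal ℝ G}
    (hcodim : Module.finrank ℝ G = Module.finrank ℝ u + 1) {b : G} (hb : b ≠ 0)
    (hborth : ∀ x ∈ u, inn b x = 0) (g : G) :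
    ∃ t : ℝ, ∃ w ∈ u, g = t • b + w := by
  have hbu : b ∉ u.toSubmodule := fun h => (hpos b hb).ne' (hborth b h)
  have hlt : u.toSubmodule < u.toSubmodule ⊔ Submodule.span ℝ {b} := by
    refine lt_of_le_of_ne le_sup_left fun h => hbu ?_
    rw [h]
    exact Submodule.mem_sup_right (Submodule.mem_span_singleton_self b)
  have hrank := Submodule.finrank_lt_finrank_of_lt hlt
  have htop : u.toSubmodule ⊔ Submodule.span ℝ {b} = ⊤ := by
    apply Submodule.eq_top_of_finrank_eq
    apply le_antisymm (Submodule.finrank_le _)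
    rw [hcodim]
    exact hrank
  have hg : g ∈ u.toSubmodule ⊔ Submodule.span ℝ {b} := htop ▸ Submodule.mem_top
  obtain ⟨w, hw, v, hv, rfl⟩ := Submodule.mem_sup.mp hg
  obtain ⟨t, rfl⟩ := Submodule.mem_span_singleton.mp hv
  exact ⟨t, w, hw, add_comm _ _⟩

end TangentLeviCivita

/-- Let `(𝔤,⟨·,·⟩)` be a metric Lie algebra with an abelian ideal `𝔲` of codimension `1`
and `b` orthogonal to `𝔲` with `[b,x] = x` for all `x ∈ 𝔲`, `λ = ⟨b,b⟩`.  Then the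
curvature tensor `R̃` of the tangent algebra `T𝔤` satisfies, for all `x, y, z ∈ 𝔲`,
the formulas of Lemma 2 on `𝔲`-lifts. -/
theorem special_tangent_curvature_formulas
    {G : Type*} [LieRing G] [LieAlgebra ℝ G] [Module.Finite ℝ G]
    (inn : G →ₗ[ℝ] G →ₗ[ℝ] ℝ)
    (hsymm : ∀ x y : G, inn x y = inn y x)
    (hpos : ∀ x : G, x ≠ 0 → 0 < inn x x)
    (u : LieIdeal ℝ G)
    (hab : ∀ x ∈ u, ∀ y ∈ u, ⁅x, y⁆ = (0 : G))
    (hcodim : Module.finrank ℝ G = Module.finrank ℝ u + 1)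
    (b : G)
    (hborth : ∀ x ∈ u, inn b x = 0)
    (hbx : ∀ x ∈ u, ⁅b, x⁆ = x)
    (tnabla : G × G → G × G → G × G)
    (htkoszul : ∀ p q r : G × G,
      2 * tangentInner inn (tnabla p q) r =
        tangentInner inn (tangentBracket p q) r
          - tangentInner inn (tangentBracket q r) p
          + tangentInner inn (tangentBracket r p) q) :
    ∀ x ∈ u, ∀ y ∈ u, ∀ z ∈ u,
      curvature tangentBracket tnabla (x, 0) (y, 0) (z, 0) =
        ((1 / inn b b) • (inn x z • y - inn y z • x), (0 : G)) ∧
      curvature tangentBracket tnabla (0, x) (0, y) (0, z) =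
        ((0 : G), (1 / inn b b) • (inn x z • y - inn y z • x)) ∧
      curvature tangentBracket tnabla (x, 0) (y, 0) (0, z) =
        (1 / (4 * inn b b)) • (inn x z • ((0, y) : G × G) - inn y z • ((0, x) : G × G)) ∧
      curvature tangentBracket tnabla (0, x) (0, y) (z, 0) =
        (1 / (4 * inn b b)) • (inn x z • ((y, 0) : G × G) - inn y z • ((x, 0) : G × G)) ∧
      curvature tangentBracket tnabla (x, 0) (0, y) (0, z) =
        (1 / (4 * inn b b)) • (inn x z • ((y, 0) : G × G) - (4 * inn y z) • ((x, 0) : G × G)) ∧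
      curvature tangentBracket tnabla (x, 0) (0, y) (z, 0) =
        (1 / (4 * inn b b)) •
          ((4 * inn x z) • ((0, y) : G × G) - inn y z • ((0, x) : G × G)) := by
  have hk : TangentKoszul inn tnabla := htkoszul
  rcases eq_or_ne b 0 with rfl | hb
  · intro x hx y hy z hz
    obtain rfl : 0 = x := by simpa using hbx x hx
    obtain rfl : 0 = y := by simpa using hbx y hy
    obtain rfl : 0 = z := by simpa using hbx z hz
    simp [curvature, Prod.mk_zero_zero, hk.zero_right hpos]
  have hdec := exists_smul_add_of_codim_one hpos hcodim hb hborth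
  have hext : ∀ p q c : G × G, (∀ s : ℝ, ∀ v ∈ u, ∀ t : ℝ, ∀ w ∈ u,
      tangentInner inn (tangentBracket p q) (s • b + v, t • b + w)
        - tangentInner inn (tangentBracket q (s • b + v, t • b + w)) p
        + tangentInner inn (tangentBracket (s • b + v, t • b + w) p) q =
      2 * tangentInner inn c (s • b + v, t • b + w)) → tnabla p q = c := by
    intro p q c hpqc
    refine eq_of_tangentInner_eq hpos fun ⟨g, h⟩ => ?_
    obtain ⟨s, v, hv, rfl⟩ := hdec g
    obtain ⟨t, w, hw, rfl⟩ := hdec h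
    rw [hk, hpqc s v hv t w hw]
  have hbb : inn b b ≠ 0 := (hpos b hb).ne'
  have hbw : ∀ (t : ℝ), ∀ w ∈ u, ⁅b, t • b + w⁆ = w := fun t w hw => by
    simp [hbx w hw]
  have hxw : ∀ x ∈ u, ∀ (t : ℝ), ∀ w ∈ u, ⁅t • b + w, x⁆ = t • x := fun x hx t w hw => by
    simp [hbx x hx, hab w hw x hx]
  have hwx : ∀ x ∈ u, ∀ (t : ℝ), ∀ w ∈ u, ⁅x, t • b + w⁆ = -(t • x) := fun x hx t w hw => by
    rw [← lie_skew, hxw x hx t w hw]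
  have hxb : ∀ x ∈ u, ⁅x, b⁆ = -x := fun x hx => by rw [← lie_skew, hbx x hx]
  have hinnb : ∀ (t : ℝ), ∀ w ∈ u, inn b (t • b + w) = t * inn b b := fun t w hw => by
    simp [hborth w hw]
  have hinnx : ∀ x ∈ u, ∀ (t : ℝ) (w : G), inn x (t • b + w) = inn x w := fun x hx t w => by
    simp [hsymm x b, hborth x hx]
  have hcc : ∀ x ∈ u, ∀ y ∈ u, tnabla (x, 0) (y, 0) = (inn x y / inn b b) • (b, 0) := by
    intro x hx y hy
    refine hext _ _ _ fun s v hv t w hw => ?_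
    simp only [tangentInner, tangentBracket, hab x hx y hy, hwx y hy s v hv, hwx y hy t w hw,
      hxw x hx s v hv, hxw x hx t w hw, hinnb s v hv, Prod.smul_mk, smul_zero, zero_lie,
      lie_zero, map_zero, map_neg, map_smul, LinearMap.zero_apply, LinearMap.neg_apply,
      LinearMap.smul_apply, smul_eq_mul, add_zero, zero_add]
    have := hsymm x y
    grind
  have hvv : ∀ x ∈ u, ∀ y ∈ u, tnabla (0, x) (0, y) = (inn x y / inn b b) • (b, 0) := by
    intro x hx y hy
    refine hext _ _ _ fun s v hv t w hw => ?_
    simp only [tangentInner, tangentBracket, hwx y hy s v hv, hxw x hx s v hv, hinnb s v hv,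
      Prod.smul_mk, smul_zero, zero_lie, lie_zero, map_zero, map_neg, map_smul,
      LinearMap.zero_apply, LinearMap.neg_apply, LinearMap.smul_apply, smul_eq_mul, add_zero,
      zero_add]
    have := hsymm x y
    grind
  have hcv : ∀ x ∈ u, ∀ y ∈ u, tnabla (x, 0) (0, y) = (inn x y / (2 * inn b b)) • (0, b) := by
    intro x hx y hy
    refine hext _ _ _ fun s v hv t w hw => ?_
    simp only [tangentInner, tangentBracket, hab x hx y hy, hwx y hy s v hv, hxw x hx s v hv,
      hxw x hx t w hw, hinnb t w hw, Prod.smul_mk, smul_zero, zero_lie, lie_zero, map_zero,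
      map_neg, map_smul, LinearMap.zero_apply, LinearMap.smul_apply, smul_eq_mul, add_zero,
      zero_add]
    have := hsymm x y
    grind
  have hvc : ∀ x ∈ u, ∀ y ∈ u, tnabla (0, x) (y, 0) = (inn x y / (2 * inn b b)) • (0, b) := by
    intro x hx y hy
    refine hext _ _ _ fun s v hv t w hw => ?_
    simp only [tangentInner, tangentBracket, hab x hx y hy, hwx y hy s v hv, hwx y hy t w hw,
      hxw x hx s v hv, hinnb t w hw, Prod.smul_mk, smul_zero, zero_lie, lie_zero, map_zero,
      map_neg, map_smul, LinearMap.zero_apply, LinearMap.neg_apply, LinearMap.smul_apply,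
      smul_eq_mul, add_zero, zero_add]
    have := hsymm x y
    grind
  have hcbc : ∀ x ∈ u, tnabla (x, 0) (b, 0) = (-1 : ℝ) • (x, 0) := by
    intro x hx
    refine hext _ _ _ fun s v hv t w hw => ?_
    simp only [tangentInner, tangentBracket, hxb x hx, hbw s v hv, hbw t w hw, hxw x hx s v hv,
      hxw x hx t w hw, hinnx x hx, Prod.smul_mk, smul_zero, zero_lie, lie_zero, map_zero,
      map_neg, map_smul, LinearMap.zero_apply, LinearMap.neg_apply, LinearMap.smul_apply,
      smul_eq_mul, add_zero, zero_add]
    have := hsymm x v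
    have := hsymm x w
    have := hsymm x b
    grind
  have hcbv : ∀ x ∈ u, tnabla (x, 0) (0, b) = (-1 / 2 : ℝ) • (0, x) := by
    intro x hx
    refine hext _ _ _ fun s v hv t w hw => ?_
    simp only [tangentInner, tangentBracket, hxb x hx, hbw s v hv, hxw x hx s v hv,
      hxw x hx t w hw, hinnx x hx, Prod.smul_mk, smul_zero, zero_lie, lie_zero, map_zero,
      map_neg, map_smul, LinearMap.zero_apply, LinearMap.neg_apply, LinearMap.smul_apply,
      smul_eq_mul, add_zero, zero_add]
    have := hsymm x v
    have := hsymm x w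
    have := hsymm x b
    grind
  have hvbc : ∀ x ∈ u, tnabla (0, x) (b, 0) = (-1 : ℝ) • (0, x) := by
    intro x hx
    refine hext _ _ _ fun s v hv t w hw => ?_
    simp only [tangentInner, tangentBracket, hxb x hx, hbw s v hv, hbw t w hw, hxw x hx s v hv,
      hinnx x hx, Prod.smul_mk, smul_zero, zero_lie, lie_zero, map_zero, map_neg, map_smul,
      LinearMap.zero_apply, LinearMap.neg_apply, LinearMap.smul_apply, smul_eq_mul, add_zero,
      zero_add]
    have := hsymm x v
    have := hsymm x w
    have := hsymm x b
    grind
  have hvbv : ∀ x ∈ u, tnabla (0, x) (0, b) = (-1 / 2 : ℝ) • (x, 0) := by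
    intro x hx
    refine hext _ _ _ fun s v hv t w hw => ?_
    simp only [tangentInner, tangentBracket, hbw s v hv, hxw x hx s v hv, hinnx x hx,
      Prod.smul_mk, smul_zero, zero_lie, lie_zero, map_zero, map_smul, LinearMap.zero_apply,
      LinearMap.smul_apply, smul_eq_mul, add_zero, zero_add]
    have := hsymm x v
    have := hsymm x w
    have := hsymm x b
    grind
  intro x hx y hy z hz
  have hzero : ∀ p q r : G × G, tangentBracket p q = 0 →
      curvature tangentBracket tnabla p q r = tnabla p (tnabla q r) - tnabla q (tnabla p r) := by
    intro p q r h
    rw [curvature, h, hk.zero_left hpos, sub_zero]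
  have hxy := hab x hx y hy
  refine ⟨?_, ?_, ?_, ?_, ?_, ?_⟩ <;> rw [hzero _ _ _ (by simp [tangentBracket, hxy])]
  · rw [hcc y hy z hz, hcc x hx z hz, hk.smul_right hpos, hk.smul_right hpos,
      hcbc x hx, hcbc y hy]
    ext <;> simp; match_scalars <;> field_simp
  · rw [hvv y hy z hz, hvv x hx z hz, hk.smul_right hpos, hk.smul_right hpos,
      hvbc x hx, hvbc y hy]
    ext <;> simp; match_scalars <;> field_simp
  · rw [hcv y hy z hz, hcv x hx z hz, hk.smul_right hpos, hk.smul_right hpos,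
      hcbv x hx, hcbv y hy]
    ext <;> simp; match_scalars <;> field_simp <;> ring
  · rw [hvc y hy z hz, hvc x hx z hz, hk.smul_right hpos, hk.smul_right hpos,
      hvbv x hx, hvbv y hy]
    ext <;> simp; match_scalars <;> field_simp <;> ring
  · rw [hvv y hy z hz, hcv x hx z hz, hk.smul_right hpos, hk.smul_right hpos,
      hcbc x hx, hvbv y hy]
    ext <;> simp; match_scalars <;> field_simp <;> ring
  · rw [hvc y hy z hz, hcc x hx z hz, hk.smul_right hpos, hk.smul_right hpos,
      hcbv x hx, hvbc y hy]
    ext <;> simp; match_scalars <;> field_simp <;> ring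
end

section
/- Let (𝔤,⟨·,·⟩) be a metric Lie algebra with an abelian ideal 𝔲 of codimension 1 and b ∈ 𝔤 orthogonal to 𝔲 with [b,x] = x for all x ∈ 𝔲, λ = ⟨b,b⟩. Then the curvature tensor R̃ of the tangent algebra T𝔤 satisfies, for all x, y ∈ 𝔲: R̃(x^c,b^v)y^c = (3⟨x,y⟩/(4λ)) b^v; R̃(x^c,b^c)y^v = R̃(x^v,b^c)y^c = (⟨x,y⟩/(2λ)) b^v; R̃(x^v,b^v)y^v = −(⟨x,y⟩/(4λ)) b^v; R̃(x^c,b^c)y^c = R̃(x^v,b^c)y^v = (⟨x,y⟩/λ) b^c; and R̃(x^c,b^v)y^v = R̃(x^v,b^v)y^c = (⟨x,y⟩/(2λ)) b^c. -/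
/-- Nondegeneracy of the lifted inner product: the Koszul formula determines the product. -/
theorem eq_of_two_mul_tangentInner_eq {G : Type*} [AddCommGroup G] [Module ℝ G]
    {inn : G →ₗ[ℝ] G →ₗ[ℝ] ℝ} (hpos : ∀ x : G, x ≠ 0 → 0 < inn x x) {p q : G × G}
    (h : ∀ r : G × G, 2 * tangentInner inn p r = 2 * tangentInner inn q r) : p = q := by
  have eq_of_inn_eq : ∀ x y : G, (∀ z, inn x z = inn y z) → x = y := by
    intro x y hxy
    by_contra hne
    have hlt := hpos (x - y) (sub_ne_zero.2 hne)
    simp only [map_sub, LinearMap.sub_apply, hxy, sub_self] at hlt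
    exact lt_irrefl _ hlt
  refine Prod.ext (eq_of_inn_eq _ _ fun z => ?_) (eq_of_inn_eq _ _ fun z => ?_)
  · simpa [tangentInner] using h (z, 0)
  · simpa [tangentInner] using h (0, z)

/-- A nonzero vector orthogonal to a hyperplane spans a complement of it. -/
theorem exists_mem_add_smul_eq {G : Type*} [AddCommGroup G] [Module ℝ G] [Module.Finite ℝ G]
    {inn : G →ₗ[ℝ] G →ₗ[ℝ] ℝ} (hpos : ∀ x : G, x ≠ 0 → 0 < inn x x) {u : Submodule ℝ G}
    (hcodim : Module.finrank ℝ G = Module.finrank ℝ u + 1) {b : G} (hb : b ≠ 0)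
    (hborth : ∀ x ∈ u, inn b x = 0) (g : G) : ∃ z ∈ u, ∃ t : ℝ, z + t • b = g := by
  have hbu : b ∉ u := fun h => (hpos b hb).ne' (hborth b h)
  have hlt : u < u ⊔ Submodule.span ℝ {b} :=
    left_lt_sup.2 fun h => hbu (h (Submodule.mem_span_singleton_self b))
  have htop : u ⊔ Submodule.span ℝ {b} = ⊤ := by
    apply Submodule.eq_top_of_finrank_eq
    have := Submodule.finrank_lt_finrank_of_lt hlt
    have := Submodule.finrank_le (u ⊔ Submodule.span ℝ {b})
    omega
  have hg : g ∈ u ⊔ Submodule.span ℝ {b} := htop ▸ Submodule.mem_top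
  obtain ⟨z, hz, w, hw, rfl⟩ := Submodule.mem_sup.1 hg
  obtain ⟨t, rfl⟩ := Submodule.mem_span_singleton.1 hw
  exact ⟨z, hz, t, rfl⟩

/-- Let `(𝔤,⟨·,·⟩)` be a metric Lie algebra with an abelian ideal `𝔲` of codimension `1`
and `b` orthogonal to `𝔲` with `[b,x] = x` for all `x ∈ 𝔲`, `λ = ⟨b,b⟩`.  Then the
curvature tensor `R̃` of the tangent algebra `T𝔤` satisfies, for all `x, y ∈ 𝔲`:
`R̃(x^c,b^v)y^c = (3⟨x,y⟩/(4λ)) b^v`, `R̃(x^c,b^c)y^v = R̃(x^v,b^c)y^c = (⟨x,y⟩/(2λ)) b^v`,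
`R̃(x^v,b^v)y^v = −(⟨x,y⟩/(4λ)) b^v`, `R̃(x^c,b^c)y^c = R̃(x^v,b^c)y^v = (⟨x,y⟩/λ) b^c`,
`R̃(x^c,b^v)y^v = R̃(x^v,b^v)y^c = (⟨x,y⟩/(2λ)) b^c`. -/
theorem special_tangent_curvature_mixed_formulas
    {G : Type*} [LieRing G] [LieAlgebra ℝ G] [Module.Finite ℝ G]
    (inn : G →ₗ[ℝ] G →ₗ[ℝ] ℝ)
    (hsymm : ∀ x y : G, inn x y = inn y x)
    (hpos : ∀ x : G, x ≠ 0 → 0 < inn x x)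
    (u : LieIdeal ℝ G)
    (hab : ∀ x ∈ u, ∀ y ∈ u, ⁅x, y⁆ = (0 : G))
    (hcodim : Module.finrank ℝ G = Module.finrank ℝ u + 1)
    (b : G)
    (hborth : ∀ x ∈ u, inn b x = 0)
    (hbx : ∀ x ∈ u, ⁅b, x⁆ = x)
    (tnabla : G × G → G × G → G × G)
    (htkoszul : ∀ p q r : G × G,
      2 * tangentInner inn (tnabla p q) r =
        tangentInner inn (tangentBracket p q) r
          - tangentInner inn (tangentBracket q r) p
          + tangentInner inn (tangentBracket r p) q) :
    ∀ x ∈ u, ∀ y ∈ u,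
      curvature tangentBracket tnabla (x, 0) (0, b) (y, 0) =
        ((0, (3 * inn x y / (4 * inn b b)) • b) : G × G) ∧
      curvature tangentBracket tnabla (x, 0) (b, 0) (0, y) =
        ((0, (inn x y / (2 * inn b b)) • b) : G × G) ∧
      curvature tangentBracket tnabla (0, x) (b, 0) (y, 0) =
        ((0, (inn x y / (2 * inn b b)) • b) : G × G) ∧
      curvature tangentBracket tnabla (0, x) (0, b) (0, y) =
        ((0, -((inn x y / (4 * inn b b)) • b)) : G × G) ∧
      curvature tangentBracket tnabla (x, 0) (b, 0) (y, 0) =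
        (((inn x y / inn b b) • b, 0) : G × G) ∧
      curvature tangentBracket tnabla (0, x) (b, 0) (0, y) =
        (((inn x y / inn b b) • b, 0) : G × G) ∧
      curvature tangentBracket tnabla (x, 0) (0, b) (0, y) =
        (((inn x y / (2 * inn b b)) • b, 0) : G × G) ∧
      curvature tangentBracket tnabla (0, x) (0, b) (y, 0) =
        (((inn x y / (2 * inn b b)) • b, 0) : G × G) := by
  have hbx' : ∀ x ∈ u, ⁅x, b⁆ = -x := fun x hx => by rw [← lie_skew, hbx x hx]
  have hborth' : ∀ x ∈ u, inn x b = 0 := fun x hx => by rw [hsymm, hborth x hx]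
  by_cases hb : b = 0
  · have hu : ∀ x ∈ u, x = 0 := fun x hx => by rw [← hbx x hx, hb, zero_lie]
    have hzero : tnabla 0 0 = 0 := by
      refine eq_of_two_mul_tangentInner_eq hpos fun r => ?_
      rw [htkoszul]
      simp [tangentInner, tangentBracket]
    intro x hx y hy
    obtain rfl := hu x hx
    obtain rfl := hu y hy
    subst hb
    simp [curvature, tangentBracket, ← Prod.zero_eq_mk, hzero]
  have hbb : inn b b ≠ 0 := (hpos b hb).ne'
  have hdecomp := exists_mem_add_smul_eq hpos (u := u.toSubmodule) hcodim hb hborth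
  have nabla_uu : ∀ x₁ ∈ u, ∀ x₂ ∈ u, ∀ y₁ ∈ u, ∀ y₂ ∈ u,
      tnabla (x₁, x₂) (y₁, y₂) = (((inn x₁ y₁ + inn x₂ y₂) / inn b b) • b,
        ((inn x₁ y₂ + inn x₂ y₁) / (2 * inn b b)) • b) := by
    intro x₁ hx₁ x₂ hx₂ y₁ hy₁ y₂ hy₂
    refine eq_of_two_mul_tangentInner_eq hpos fun ⟨r₁, r₂⟩ => ?_
    obtain ⟨z₁, hz₁, s, rfl⟩ := hdecomp r₁
    obtain ⟨z₂, hz₂, t, rfl⟩ := hdecomp r₂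
    rw [LieSubmodule.mem_toSubmodule] at hz₁ hz₂
    rw [htkoszul]
    simp [tangentInner, tangentBracket, *]
    field_simp
    ring
  have nabla_bu : ∀ s t : ℝ, ∀ x₁ ∈ u, ∀ x₂ ∈ u,
      tnabla (s • b, t • b) (x₁, x₂) = (-(t / 2) • x₂, (t / 2) • x₁) := by
    intro s t x₁ hx₁ x₂ hx₂
    refine eq_of_two_mul_tangentInner_eq hpos fun ⟨r₁, r₂⟩ => ?_
    obtain ⟨z₁, hz₁, s', rfl⟩ := hdecomp r₁
    obtain ⟨z₂, hz₂, t', rfl⟩ := hdecomp r₂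
    rw [LieSubmodule.mem_toSubmodule] at hz₁ hz₂
    rw [htkoszul]
    simp [tangentInner, tangentBracket, *]
    ring
  have nabla_bb : ∀ s t s' t' : ℝ, tnabla (s • b, t • b) (s' • b, t' • b) = 0 := by
    intro s t s' t'
    refine eq_of_two_mul_tangentInner_eq hpos fun ⟨r₁, r₂⟩ => ?_
    obtain ⟨z₁, hz₁, c, rfl⟩ := hdecomp r₁
    obtain ⟨z₂, hz₂, d, rfl⟩ := hdecomp r₂
    rw [LieSubmodule.mem_toSubmodule] at hz₁ hz₂
    rw [htkoszul]
    simp [tangentInner, tangentBracket, *]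
  have curvature_ubu : ∀ s t : ℝ, ∀ x₁ ∈ u, ∀ x₂ ∈ u, ∀ y₁ ∈ u, ∀ y₂ ∈ u,
      curvature tangentBracket tnabla (x₁, x₂) (s • b, t • b) (y₁, y₂) =
        (((s * (inn x₁ y₁ + inn x₂ y₂) + t / 2 * (inn x₁ y₂ + inn x₂ y₁)) / inn b b) • b,
          ((2 * s * (inn x₁ y₂ + inn x₂ y₁) + t * (3 * inn x₁ y₁ - inn x₂ y₂)) /
            (4 * inn b b)) • b) := by
    intro s t x₁ hx₁ x₂ hx₂ y₁ hy₁ y₂ hy₂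
    have hbr : tangentBracket (x₁, x₂) (s • b, t • b) = (-s • x₁, -t • x₁ + -s • x₂) := by
      simp [tangentBracket, *]
    rw [curvature, hbr, nabla_bu s t y₁ hy₁ y₂ hy₂, nabla_uu x₁ hx₁ x₂ hx₂ y₁ hy₁ y₂ hy₂,
      nabla_bb, nabla_uu x₁ hx₁ x₂ hx₂ _ (u.smul_mem _ hy₂) _ (u.smul_mem _ hy₁),
      nabla_uu _ (u.smul_mem _ hx₁) _ (u.add_mem (u.smul_mem _ hx₁) (u.smul_mem _ hx₂))
        y₁ hy₁ y₂ hy₂]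
    simp only [sub_zero, Prod.mk_sub_mk, ← sub_smul, map_add, map_smul, LinearMap.add_apply,
      LinearMap.smul_apply, smul_eq_mul]
    congr 2 <;> field_simp <;> ring
  intro x hx y hy
  have h0 := u.zero_mem
  have curvature_bv : ∀ x₁ ∈ u, ∀ x₂ ∈ u, ∀ y₁ ∈ u, ∀ y₂ ∈ u, _ := curvature_ubu 0 1
  have curvature_bc : ∀ x₁ ∈ u, ∀ x₂ ∈ u, ∀ y₁ ∈ u, ∀ y₂ ∈ u, _ := curvature_ubu 1 0
  simp only [zero_smul, one_smul] at curvature_bv curvature_bc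
  refine ⟨?_, ?_, ?_, ?_, ?_, ?_, ?_, ?_⟩
  · rw [curvature_bv x hx 0 h0 y hy 0 h0]; simp
  · rw [curvature_bc x hx 0 h0 0 h0 y hy]; simp; congr 1; ring
  · rw [curvature_bc 0 h0 x hx y hy 0 h0]; simp; congr 1; ring
  · rw [curvature_bv 0 h0 x hx 0 h0 y hy]; simp [neg_div]
  · rw [curvature_bc x hx 0 h0 y hy 0 h0]; simp
  · rw [curvature_bc 0 h0 x hx 0 h0 y hy]; simp
  · rw [curvature_bv x hx 0 h0 0 h0 y hy]; simp; field_simp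
  · rw [curvature_bv 0 h0 x hx y hy 0 h0]; simp; field_simp
end

section
/- Let (𝔤,⟨·,·⟩) be a metric Lie algebra with an abelian ideal 𝔲 of codimension 1 and b ∈ 𝔤 orthogonal to 𝔲 with [b,x] = x for all x ∈ 𝔲, λ = ⟨b,b⟩. Then the sectional curvature K̃ of the tangent algebra T𝔤 satisfies: for all linearly independent x, y ∈ 𝔲, K̃(x^c,y^c) = K̃(x^v,y^v) = −1/λ; for all nonzero x, y ∈ 𝔲, K̃(x^c,y^v) = −1/λ + ⟨x,y⟩²/(4λ⟨x,x⟩⟨y,y⟩); and for all nonzero x ∈ 𝔲, K̃(x^c,b^c) = K̃(x^v,b^c) = −1/λ, K̃(x^c,b^v) = −3/(4λ), and K̃(x^v,b^v) = 1/(4λ). -/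
/-- Sectional curvature `K(x,y) = ⟨R(x,y)y,x⟩ / (⟨x,x⟩⟨y,y⟩ − ⟨x,y⟩²)`. -/
noncomputable def sectional {A : Type*} (ip : A → A → ℝ) (R : A → A → A → A) (x y : A) : ℝ :=
  ip (R x y y) x / (ip x x * ip y y - ip x y ^ 2)

namespace SpecialTangent

/-- The element `(x₁ + α₁ b, x₂ + α₂ b)` of `T𝔤`, for `x₁, x₂ ∈ 𝔲`. -/
def mk {G : Type*} [LieRing G] [LieAlgebra ℝ G] {u : LieIdeal ℝ G} (b : G)
    (x₁ x₂ : u) (α₁ α₂ : ℝ) : G × G :=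
  ((x₁ : G) + α₁ • b, (x₂ : G) + α₂ • b)

variable {G : Type*} [LieRing G] [LieAlgebra ℝ G]

theorem exists_decomposition [Module.Finite ℝ G] {u : LieIdeal ℝ G} {b : G}
    (hcodim : Module.finrank ℝ G = Module.finrank ℝ u + 1) (hb : b ∉ u) (g : G) :
    ∃ (x : u) (α : ℝ), g = (x : G) + α • b := by
  have hlt : u.toSubmodule < u.toSubmodule ⊔ Submodule.span ℝ {b} := by
    refine lt_of_le_of_ne le_sup_left fun h => hb ?_
    have hmem : b ∈ u.toSubmodule ⊔ Submodule.span ℝ {b} :=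
      Submodule.mem_sup_right (Submodule.mem_span_singleton_self b)
    rw [← h] at hmem
    exact hmem
  have htop : u.toSubmodule ⊔ Submodule.span ℝ {b} = ⊤ := by
    apply Submodule.eq_top_of_finrank_eq
    refine le_antisymm (Submodule.finrank_le _) ?_
    rw [hcodim]
    exact Submodule.finrank_lt_finrank_of_lt hlt
  have hg : g ∈ u.toSubmodule ⊔ Submodule.span ℝ {b} := htop ▸ Submodule.mem_top
  obtain ⟨x, hx, y, hy, rfl⟩ := Submodule.mem_sup.1 hg
  obtain ⟨α, rfl⟩ := Submodule.mem_span_singleton.1 hy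
  exact ⟨⟨x, hx⟩, α, rfl⟩

theorem tangentBracket_mk {u : LieIdeal ℝ G} {b : G}
    (hab : ∀ x ∈ u, ∀ y ∈ u, ⁅x, y⁆ = (0 : G)) (hbx : ∀ x ∈ u, ⁅b, x⁆ = x)
    (x₁ x₂ y₁ y₂ : u) (α₁ α₂ β₁ β₂ : ℝ) :
    tangentBracket (mk b x₁ x₂ α₁ α₂) (mk b y₁ y₂ β₁ β₂) =
      mk b (α₁ • y₁ - β₁ • x₁) (α₁ • y₂ - β₂ • x₁ + α₂ • y₁ - β₁ • x₂) 0 0 := by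
  have hxb : ∀ x ∈ u, ⁅x, b⁆ = -x := fun x hx => by rw [← lie_skew, hbx x hx]
  have key : ∀ (x y : u) (α β : ℝ),
      ⁅(x : G) + α • b, (y : G) + β • b⁆ = α • (y : G) - β • (x : G) := fun x y α β => by
    simp only [add_lie, lie_add, smul_lie, lie_smul, hab x x.2 y y.2, hbx y y.2, hxb x x.2,
      lie_self]
    module
  simp only [tangentBracket, mk, key, Prod.mk.injEq]
  constructor <;> push_cast <;> module

theorem tangentInner_mk {inn : G →ₗ[ℝ] G →ₗ[ℝ] ℝ} (hsymm : ∀ x y : G, inn x y = inn y x)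
    {u : LieIdeal ℝ G} {b : G} (hborth : ∀ x ∈ u, inn b x = 0)
    (x₁ x₂ y₁ y₂ : u) (α₁ α₂ β₁ β₂ : ℝ) :
    tangentInner inn (mk b x₁ x₂ α₁ α₂) (mk b y₁ y₂ β₁ β₂) =
      inn x₁ y₁ + inn x₂ y₂ + (α₁ * β₁ + α₂ * β₂) * inn b b := by
  have hxb : ∀ x : u, inn (x : G) b = 0 := fun x => by rw [hsymm, hborth x x.2]
  have hbx : ∀ x : u, inn b (x : G) = 0 := fun x => hborth x x.2
  simp only [tangentInner, mk, map_add, map_smul, LinearMap.add_apply, LinearMap.smul_apply,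
    hxb, hbx, smul_eq_mul]
  ring

theorem eq_of_tangentInner_eq {inn : G →ₗ[ℝ] G →ₗ[ℝ] ℝ} (hpos : ∀ x : G, x ≠ 0 → 0 < inn x x)
    {p q : G × G} (h : ∀ r, tangentInner inn p r = tangentInner inn q r) : p = q := by
  have aux : ∀ x y : G, inn x (x - y) = inn y (x - y) → x = y := fun x y hxy => by
    by_contra hne
    have h0 := hpos (x - y) (sub_ne_zero.2 hne)
    rw [map_sub inn x y, LinearMap.sub_apply, hxy, sub_self] at h0
    exact lt_irrefl _ h0
  refine Prod.ext (aux _ _ ?_) (aux _ _ ?_)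
  · simpa [tangentInner] using h (p.1 - q.1, 0)
  · simpa [tangentInner] using h (0, p.2 - q.2)

/-- The Levi-Civita product of `T𝔤` in the decomposition `𝔤 = 𝔲 ⊕ ℝ b`. -/
theorem leviCivita_mk [Module.Finite ℝ G] {inn : G →ₗ[ℝ] G →ₗ[ℝ] ℝ}
    (hsymm : ∀ x y : G, inn x y = inn y x) (hpos : ∀ x : G, x ≠ 0 → 0 < inn x x)
    {u : LieIdeal ℝ G} (hab : ∀ x ∈ u, ∀ y ∈ u, ⁅x, y⁆ = (0 : G))
    (hcodim : Module.finrank ℝ G = Module.finrank ℝ u + 1)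
    {b : G} (hb : b ≠ 0) (hborth : ∀ x ∈ u, inn b x = 0) (hbx : ∀ x ∈ u, ⁅b, x⁆ = x)
    {tnabla : G × G → G × G → G × G}
    (htkoszul : ∀ p q r : G × G,
      2 * tangentInner inn (tnabla p q) r =
        tangentInner inn (tangentBracket p q) r
          - tangentInner inn (tangentBracket q r) p
          + tangentInner inn (tangentBracket r p) q)
    (x₁ x₂ y₁ y₂ : u) (α₁ α₂ β₁ β₂ : ℝ) :
    tnabla (mk b x₁ x₂ α₁ α₂) (mk b y₁ y₂ β₁ β₂) =
      mk b (-(β₁ • x₁) - (α₂ / 2) • y₂ - (β₂ / 2) • x₂)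
        (-(β₁ • x₂) + (α₂ / 2) • y₁ - (β₂ / 2) • x₁)
        ((inn x₁ y₁ + inn x₂ y₂) / inn b b) ((inn x₁ y₂ + inn x₂ y₁) / (2 * inn b b)) := by
  have hbb : inn b b ≠ 0 := (hpos b hb).ne'
  have hbu : b ∉ u := fun h => hbb (hborth b h)
  refine eq_of_tangentInner_eq hpos fun ⟨r₁, r₂⟩ => ?_
  obtain ⟨z₁, γ₁, rfl⟩ := exists_decomposition hcodim hbu r₁
  obtain ⟨z₂, γ₂, rfl⟩ := exists_decomposition hcodim hbu r₂
  change tangentInner inn _ (mk b z₁ z₂ γ₁ γ₂) = tangentInner inn _ (mk b z₁ z₂ γ₁ γ₂)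
  refine mul_left_cancel₀ (two_ne_zero (α := ℝ)) ?_
  rw [htkoszul]
  simp only [tangentBracket_mk hab hbx, tangentInner_mk hsymm hborth]
  push_cast
  simp only [map_add, map_sub, map_neg, map_smul, LinearMap.add_apply, LinearMap.sub_apply,
    LinearMap.neg_apply, LinearMap.smul_apply, smul_eq_mul]
  rw [hsymm z₁ x₁, hsymm z₁ x₂, hsymm z₁ y₁, hsymm z₁ y₂, hsymm z₂ x₂, hsymm z₂ y₂,
    hsymm y₁ x₁, hsymm y₁ x₂, hsymm y₂ x₂]
  field_simp
  ring

theorem gram_ne_zero {inn : G →ₗ[ℝ] G →ₗ[ℝ] ℝ} (hsymm : ∀ x y : G, inn x y = inn y x)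
    (hpos : ∀ x : G, x ≠ 0 → 0 < inn x x) {x y : G} (h : LinearIndependent ℝ ![x, y]) :
    inn x x * inn y y - inn x y ^ 2 ≠ 0 := by
  rw [LinearIndependent.pair_iff] at h
  have hy : y ≠ 0 := by
    rintro rfl
    simpa using h 0 1 (by simp)
  have hyy := hpos y hy
  have hw : inn y y • x + (-inn x y) • y ≠ 0 := fun h0 => hyy.ne' (h _ _ h0).1
  have hww := hpos _ hw
  simp only [map_add, map_smul, LinearMap.add_apply, LinearMap.smul_apply, smul_eq_mul,
    hsymm y x] at hww
  have : 0 < inn y y * (inn x x * inn y y - inn x y ^ 2) := by linarith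
  exact (pos_of_mul_pos_right this hyy.le).ne'

end SpecialTangent

open SpecialTangent

/-- Let `(𝔤,⟨·,·⟩)` be a metric Lie algebra with an abelian ideal `𝔲` of codimension `1`
and `b` orthogonal to `𝔲` with `[b,x] = x` for all `x ∈ 𝔲`, `λ = ⟨b,b⟩`.  Then the
sectional curvature `K̃` of the tangent algebra `T𝔤` satisfies: for linearly independent
`x, y ∈ 𝔲`, `K̃(x^c,y^c) = K̃(x^v,y^v) = −1/λ`; for nonzero `x, y ∈ 𝔲`,
`K̃(x^c,y^v) = −1/λ + ⟨x,y⟩²/(4λ⟨x,x⟩⟨y,y⟩)`; and for nonzero `x ∈ 𝔲`,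
`K̃(x^c,b^c) = K̃(x^v,b^c) = −1/λ`, `K̃(x^c,b^v) = −3/(4λ)`, `K̃(x^v,b^v) = 1/(4λ)`. -/
theorem special_tangent_sectional_formulas
    {G : Type*} [LieRing G] [LieAlgebra ℝ G] [Module.Finite ℝ G]
    (inn : G →ₗ[ℝ] G →ₗ[ℝ] ℝ)
    (hsymm : ∀ x y : G, inn x y = inn y x)
    (hpos : ∀ x : G, x ≠ 0 → 0 < inn x x)
    (u : LieIdeal ℝ G)
    (hab : ∀ x ∈ u, ∀ y ∈ u, ⁅x, y⁆ = (0 : G))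
    (hcodim : Module.finrank ℝ G = Module.finrank ℝ u + 1)
    (b : G)
    (hborth : ∀ x ∈ u, inn b x = 0)
    (hbx : ∀ x ∈ u, ⁅b, x⁆ = x)
    (tnabla : G × G → G × G → G × G)
    (htkoszul : ∀ p q r : G × G,
      2 * tangentInner inn (tnabla p q) r =
        tangentInner inn (tangentBracket p q) r
          - tangentInner inn (tangentBracket q r) p
          + tangentInner inn (tangentBracket r p) q) :
    (∀ x ∈ u, ∀ y ∈ u, LinearIndependent ℝ ![x, y] →
      sectional (tangentInner inn) (curvature tangentBracket tnabla)
          ((x, 0) : G × G) ((y, 0) : G × G) = -(1 / inn b b) ∧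
      sectional (tangentInner inn) (curvature tangentBracket tnabla)
          ((0, x) : G × G) ((0, y) : G × G) = -(1 / inn b b)) ∧
    (∀ x ∈ u, ∀ y ∈ u, x ≠ 0 → y ≠ 0 →
      sectional (tangentInner inn) (curvature tangentBracket tnabla)
          ((x, 0) : G × G) ((0, y) : G × G) =
        -(1 / inn b b) + inn x y ^ 2 / (4 * inn b b * inn x x * inn y y)) ∧
    (∀ x ∈ u, x ≠ 0 →
      sectional (tangentInner inn) (curvature tangentBracket tnabla)
          ((x, 0) : G × G) ((b, 0) : G × G) = -(1 / inn b b) ∧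
      sectional (tangentInner inn) (curvature tangentBracket tnabla)
          ((0, x) : G × G) ((b, 0) : G × G) = -(1 / inn b b) ∧
      sectional (tangentInner inn) (curvature tangentBracket tnabla)
          ((x, 0) : G × G) ((0, b) : G × G) = -(3 / (4 * inn b b)) ∧
      sectional (tangentInner inn) (curvature tangentBracket tnabla)
          ((0, x) : G × G) ((0, b) : G × G) = 1 / (4 * inn b b)) := by
  have hb : ∀ x ∈ u, x ≠ 0 → b ≠ 0 := by
    rintro x hx hx0 rfl
    exact hx0 (by simpa using (hbx x hx).symm)
  have hc : ∀ x : u, (((x : G), 0) : G × G) = mk b x 0 0 0 := fun x => by simp [mk]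
  have hv : ∀ x : u, ((0, (x : G)) : G × G) = mk b 0 x 0 0 := fun x => by simp [mk]
  have hbc : ((b, 0) : G × G) = mk b (0 : u) 0 1 0 := by simp [mk]
  have hbv : ((0, b) : G × G) = mk b (0 : u) 0 0 1 := by simp [mk]
  have hsub : ∀ (x₁ x₂ y₁ y₂ : u) (α₁ α₂ β₁ β₂ : ℝ),
      mk b x₁ x₂ α₁ α₂ - mk b y₁ y₂ β₁ β₂ =
        mk b (x₁ - y₁) (x₂ - y₂) (α₁ - β₁) (α₂ - β₂) := fun _ _ _ _ _ _ _ _ => by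
    simp only [mk, Prod.mk_sub_mk, Prod.mk.injEq]
    constructor <;> push_cast <;> module
  refine ⟨fun x hx y hy hxy => ?_, fun x hx y hy hx0 hy0 => ?_, fun x hx hx0 => ?_⟩
  · have hb0 := hb x hx (hxy.ne_zero 0)
    have hbb := (hpos b hb0).ne'
    have hg := gram_ne_zero hsymm hpos hxy
    lift x to u using hx
    lift y to u using hy
    rw [hc, hc, hv, hv]
    simp only [sectional, curvature, tangentBracket_mk hab hbx, tangentInner_mk hsymm hborth, hsub,
      leviCivita_mk hsymm hpos hab hcodim hb0 hborth hbx htkoszul]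
    rw [mul_comm] at hg
    constructor <;> simp [hsymm y x, mul_comm (inn (x : G) x)] <;> field_simp <;> ring
  · have hb0 := hb x hx hx0
    have hbb := (hpos b hb0).ne'
    have hxx := (hpos x hx0).ne'
    have hyy := (hpos y hy0).ne'
    lift x to u using hx
    lift y to u using hy
    rw [hc, hv]
    simp only [sectional, curvature, tangentBracket_mk hab hbx, tangentInner_mk hsymm hborth, hsub,
      leviCivita_mk hsymm hpos hab hcodim hb0 hborth hbx htkoszul]
    simp [hsymm y x]
    field_simp
    ring
  · have hb0 := hb x hx hx0
    have hbb := (hpos b hb0).ne'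
    have hxx := (hpos x hx0).ne'
    lift x to u using hx
    rw [hc, hv, hbc, hbv]
    simp only [sectional, curvature, tangentBracket_mk hab hbx, tangentInner_mk hsymm hborth, hsub,
      leviCivita_mk hsymm hpos hab hcodim hb0 hborth hbx htkoszul]
    refine ⟨?_, ?_, ?_, ?_⟩ <;> simp <;> field_simp <;> ring
end

section
/- Let (𝔤,⟨·,·⟩) be a metric Lie algebra whose derived algebra is one-dimensional and spanned by a unit vector e, with Γ = e^⊥, a ∈ Γ satisfying [x,e] = ⟨a,x⟩e for all x ∈ Γ, and skew-adjoint f : Γ → Γ satisfying [x,y] = ⟨f(x),y⟩e for all x,y ∈ Γ. Then the Levi-Civita product ∇ of (𝔤,⟨·,·⟩) satisfies, for all x, y ∈ Γ: ∇_e e = a, ∇_e x = −½f(x) − ⟨x,a⟩e, ∇_x e = −½f(x), and ∇_x y = ½⟨f(x),y⟩e. -/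
/-- Two vectors with the same inner products against a unit vector `e` and against every vector
orthogonal to `e` are equal. -/
theorem eq_of_inner_unit_of_inner_orthogonal
    {V : Type*} [AddCommGroup V] [Module ℝ V] {B : V →ₗ[ℝ] V →ₗ[ℝ] ℝ}
    (hpos : ∀ x : V, x ≠ 0 → 0 < B x x) {e : V} (hunit : B e e = 1) {u v : V}
    (he : B u e = B v e) (horth : ∀ z : V, B e z = 0 → B u z = B v z) : u = v := by
  have hall : ∀ z : V, B u z = B v z := fun z => by
    have hz := horth (z - B e z • e) (by simp [hunit])
    simp only [map_sub, map_smul, smul_eq_mul, he] at hz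
    linarith
  by_contra hne
  have huv := hpos (u - v) (sub_ne_zero.mpr hne)
  simp [hall] at huv


/-- Let `(𝔤,⟨·,·⟩)` be a metric Lie algebra whose derived algebra is one-dimensional and
spanned by a unit vector `e`, with `Γ = e^⊥`, `a ∈ Γ` satisfying `[x,e] = ⟨a,x⟩e` for all
`x ∈ Γ`, and skew-adjoint `f : Γ → Γ` satisfying `[x,y] = ⟨f(x),y⟩e` for all `x,y ∈ Γ`.
Then the Levi-Civita product `∇` of `(𝔤,⟨·,·⟩)` (characterized by the Koszul formula)
satisfies, for all `x, y ∈ Γ`: `∇_e e = a`, `∇_e x = −½f(x) − ⟨x,a⟩e`,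
`∇_x e = −½f(x)`, and `∇_x y = ½⟨f(x),y⟩e`. -/
theorem oneDimCommutator_leviCivita_formulas
    {G : Type*} [LieRing G] [LieAlgebra ℝ G] [Module.Finite ℝ G]
    (inn : G →ₗ[ℝ] G →ₗ[ℝ] ℝ)
    (hsymm : ∀ x y : G, inn x y = inn y x)
    (hpos : ∀ x : G, x ≠ 0 → 0 < inn x x)
    (e : G) (hunit : inn e e = 1)
    (hder : Submodule.span ℝ {z : G | ∃ x y : G, ⁅x, y⁆ = z} =
      Submodule.span ℝ ({e} : Set G))
    (a : G) (haG : inn e a = 0)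
    (haxe : ∀ x : G, inn e x = 0 → ⁅x, e⁆ = inn a x • e)
    (f : G →ₗ[ℝ] G)
    (hfG : ∀ x : G, inn e x = 0 → inn e (f x) = 0)
    (hskew : ∀ x y : G, inn e x = 0 → inn e y = 0 → inn (f x) y = -inn x (f y))
    (hfbr : ∀ x y : G, inn e x = 0 → inn e y = 0 → ⁅x, y⁆ = inn (f x) y • e)
    (nabla : G → G → G)
    (hkoszul : ∀ x y z : G,
      2 * inn (nabla x y) z = inn ⁅x, y⁆ z - inn ⁅y, z⁆ x + inn ⁅z, x⁆ y) :
    nabla e e = a ∧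
    (∀ x : G, inn e x = 0 → nabla e x = -((1/2 : ℝ) • f x) - inn x a • e) ∧
    (∀ x : G, inn e x = 0 → nabla x e = -((1/2 : ℝ) • f x)) ∧
    (∀ x y : G, inn e x = 0 → inn e y = 0 →
      nabla x y = ((1/2 : ℝ) * inn (f x) y) • e) := by
  have hxe : ∀ x : G, inn e x = 0 → inn x e = 0 := fun x hx => (hsymm x e).trans hx
  have hex : ∀ x : G, inn e x = 0 → ⁅e, x⁆ = -(inn a x • e) := fun x hx => by
    rw [← haxe x hx, lie_skew]
  refine ⟨?_, fun x hx => ?_, fun x hx => ?_, fun x y hx hy => ?_⟩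
  · refine eq_of_inner_unit_of_inner_orthogonal hpos hunit ?_ fun z hz => ?_
    · have h := hkoszul e e e
      simp at h
      rw [h, hxe a haG]
    · have h := hkoszul e e z
      simp [haxe z hz, hex z hz, hunit] at h
      linarith
  · refine eq_of_inner_unit_of_inner_orthogonal hpos hunit ?_ fun z hz => ?_
    · have h := hkoszul e x e
      simp [haxe x hx, hex x hx, hunit] at h
      simp [hxe _ (hfG x hx), hunit, hsymm x a]
      linarith
    · have h := hkoszul e x z
      simp [haxe z hz, hex x hx, hfbr x z hx hz, hunit, hx, hz] at h
      simp [hz]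
      linarith
  · refine eq_of_inner_unit_of_inner_orthogonal hpos hunit ?_ fun z hz => ?_
    · have h := hkoszul x e e
      simp [haxe x hx, hex x hx, hunit] at h
      simp [hxe _ (hfG x hx), h]
    · have h := hkoszul x e z
      simp [haxe x hx, hex z hz, hfbr z x hz hx, hunit, hx, hz] at h
      simp
      linarith [hskew z x hz hx, hsymm z (f x)]
  · refine eq_of_inner_unit_of_inner_orthogonal hpos hunit ?_ fun z hz => ?_
    · have h := hkoszul x y e
      simp [haxe y hy, hex x hx, hfbr x y hx hy, hunit, hx, hy] at h
      simp [hunit]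
      linarith
    · have h := hkoszul x y z
      simp [hfbr x y hx hy, hfbr y z hy hz, hfbr z x hz hx, hx, hy, hz] at h
      simp [hz, h]
end

section
/- Let (𝔤,⟨·,·⟩) be a metric Lie algebra whose derived algebra is one-dimensional and spanned by a unit vector e, with Γ = e^⊥, a ∈ Γ satisfying [x,e] = ⟨a,x⟩e for all x ∈ Γ, and skew-adjoint f : Γ → Γ satisfying [x,y] = ⟨f(x),y⟩e for all x,y ∈ Γ. Then the sectional curvature K of (𝔤,⟨·,·⟩) satisfies: for all orthonormal x, y ∈ Γ, K(x,y) = −(3/4)⟨f(x),y⟩², and for every unit vector x ∈ Γ, K(x,e) = (1/4)‖f(x)‖² − ⟨a,x⟩². -/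
/-- Two vectors are equal if a positive definite form pairs them equally with a unit vector `e`
and with every vector orthogonal to `e`. -/
theorem eq_of_pairings_eq {G : Type*} [AddCommGroup G] [Module ℝ G]
    (inn : G →ₗ[ℝ] G →ₗ[ℝ] ℝ) (hpos : ∀ x : G, x ≠ 0 → 0 < inn x x)
    {e : G} (hunit : inn e e = 1) {u v : G} (he : inn u e = inn v e)
    (horth : ∀ z : G, inn e z = 0 → inn u z = inn v z) : u = v := by
  have key (z : G) : inn u z = inn v z := by
    have h := horth (z - inn e z • e) (by simp [hunit])
    simp only [map_sub, map_smul, smul_eq_mul, he] at h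
    linarith
  by_contra hne
  have h := hpos (u - v) (sub_ne_zero.mpr hne)
  simp [key] at h

/-- Let `(𝔤,⟨·,·⟩)` be a metric Lie algebra whose derived algebra is one-dimensional and
spanned by a unit vector `e`, with `Γ = e^⊥`, `a ∈ Γ` satisfying `[x,e] = ⟨a,x⟩e` for all
`x ∈ Γ`, and skew-adjoint `f : Γ → Γ` satisfying `[x,y] = ⟨f(x),y⟩e` for all `x,y ∈ Γ`.
Then the sectional curvature `K` of `(𝔤,⟨·,·⟩)` satisfies: for orthonormal `x, y ∈ Γ`,
`K(x,y) = −(3/4)⟨f(x),y⟩²`, and for every unit vector `x ∈ Γ`,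
`K(x,e) = (1/4)‖f(x)‖² − ⟨a,x⟩²`. -/
theorem oneDimCommutator_sectional_formulas
    {G : Type*} [LieRing G] [LieAlgebra ℝ G] [Module.Finite ℝ G]
    (inn : G →ₗ[ℝ] G →ₗ[ℝ] ℝ)
    (hsymm : ∀ x y : G, inn x y = inn y x)
    (hpos : ∀ x : G, x ≠ 0 → 0 < inn x x)
    (e : G) (hunit : inn e e = 1)
    (hder : Submodule.span ℝ {z : G | ∃ x y : G, ⁅x, y⁆ = z} =
      Submodule.span ℝ ({e} : Set G))
    (a : G) (haG : inn e a = 0)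
    (haxe : ∀ x : G, inn e x = 0 → ⁅x, e⁆ = inn a x • e)
    (f : G →ₗ[ℝ] G)
    (hfG : ∀ x : G, inn e x = 0 → inn e (f x) = 0)
    (hskew : ∀ x y : G, inn e x = 0 → inn e y = 0 → inn (f x) y = -inn x (f y))
    (hfbr : ∀ x y : G, inn e x = 0 → inn e y = 0 → ⁅x, y⁆ = inn (f x) y • e)
    (nabla : G → G → G)
    (hkoszul : ∀ x y z : G,
      2 * inn (nabla x y) z = inn ⁅x, y⁆ z - inn ⁅y, z⁆ x + inn ⁅z, x⁆ y) :
    (∀ x y : G, inn e x = 0 → inn e y = 0 →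
      inn x x = 1 → inn y y = 1 → inn x y = 0 →
      sectional (fun p q => inn p q)
          (curvature (fun p q => ⁅p, q⁆) nabla) x y = -(3/4) * inn (f x) y ^ 2) ∧
    (∀ x : G, inn e x = 0 → inn x x = 1 →
      sectional (fun p q => inn p q)
          (curvature (fun p q => ⁅p, q⁆) nabla) x e =
        (1/4) * inn (f x) (f x) - inn a x ^ 2) := by
  have hex (x : G) (hx : inn e x = 0) : ⁅e, x⁆ = -(inn a x • e) := by
    rw [← lie_skew, haxe x hx]
  have hxe (x : G) (hx : inn e x = 0) : inn x e = 0 := by rw [hsymm, hx]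
  have nabla_smul (c : ℝ) (x y : G) : nabla x (c • y) = c • nabla x y := by
    refine eq_of_pairings_eq inn hpos hunit ?_ fun z _ => ?_
    · have h₁ := hkoszul x (c • y) e
      have h₂ := hkoszul x y e
      simp only [lie_smul, smul_lie, map_smul, LinearMap.smul_apply, smul_eq_mul] at h₁ ⊢
      linear_combination h₁ / 2 - c * h₂ / 2
    · have h₁ := hkoszul x (c • y) z
      have h₂ := hkoszul x y z
      simp only [lie_smul, smul_lie, map_smul, LinearMap.smul_apply, smul_eq_mul] at h₁ ⊢
      linear_combination h₁ / 2 - c * h₂ / 2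
  have smul_nabla (c : ℝ) (x y : G) : nabla (c • x) y = c • nabla x y := by
    refine eq_of_pairings_eq inn hpos hunit ?_ fun z _ => ?_
    · have h₁ := hkoszul (c • x) y e
      have h₂ := hkoszul x y e
      simp only [lie_smul, smul_lie, map_smul, LinearMap.smul_apply, smul_eq_mul] at h₁ ⊢
      linear_combination h₁ / 2 - c * h₂ / 2
    · have h₁ := hkoszul (c • x) y z
      have h₂ := hkoszul x y z
      simp only [lie_smul, smul_lie, map_smul, LinearMap.smul_apply, smul_eq_mul] at h₁ ⊢
      linear_combination h₁ / 2 - c * h₂ / 2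
  have nabla_orth (x y : G) (hx : inn e x = 0) (hy : inn e y = 0) :
      nabla x y = (inn (f x) y / 2) • e := by
    refine eq_of_pairings_eq inn hpos hunit ?_ fun z hz => ?_
    · have h := hkoszul x y e
      simp [hfbr x y hx hy, haxe y hy, hex x hx, hunit, hx, hy] at h ⊢
      linarith
    · have h := hkoszul x y z
      simp [hfbr x y hx hy, hfbr y z hy hz, hfbr z x hz hx, hx, hy, hz] at h ⊢
      linarith
  have nabla_e (x : G) (hx : inn e x = 0) : nabla x e = (-(1 / 2) : ℝ) • f x := by
    refine eq_of_pairings_eq inn hpos hunit ?_ fun z hz => ?_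
    · have h := hkoszul x e e
      simp [haxe x hx, hex x hx, hunit, hxe _ (hfG x hx)] at h ⊢
      linarith
    · have h := hkoszul x e z
      have hs := hskew z x hz hx
      have hc := hsymm z (f x)
      simp [haxe x hx, hex z hz, hfbr z x hz hx, hx, hz, hunit] at h ⊢
      linarith
  have e_nabla (y : G) (hy : inn e y = 0) :
      nabla e y = (-(1 / 2) : ℝ) • f y - inn a y • e := by
    refine eq_of_pairings_eq inn hpos hunit ?_ fun z hz => ?_
    · have h := hkoszul e y e
      simp [haxe y hy, hex y hy, hunit, hxe _ (hfG y hy)] at h ⊢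
      linarith
    · have h := hkoszul e y z
      simp [haxe z hz, hex y hy, hfbr y z hy hz, hy, hz, hunit] at h ⊢
      linarith
  have e_nabla_e : nabla e e = a := by
    refine eq_of_pairings_eq inn hpos hunit ?_ fun z hz => ?_
    · have h := hkoszul e e e
      simp at h
      rw [h, hxe a haG]
    · have h := hkoszul e e z
      simp [haxe z hz, hex z hz, hunit] at h
      linarith
  refine ⟨fun x y hx hy hxx hyy hxy => ?_, fun x hx hxx => ?_⟩
  · have hs := hskew y x hy hx
    have hc := hsymm y (f x)
    have hyfy : inn (f y) y = 0 := by
      have h₁ := hskew y y hy hy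
      have h₂ := hsymm y (f y)
      linarith
    have hfyx : inn (f y) x = -inn (f x) y := by linarith
    simp only [sectional, curvature, hfbr x y hx hy, nabla_orth x y hx hy,
      nabla_orth y y hy hy, nabla_smul, smul_nabla, nabla_e x hx, nabla_e y hy, e_nabla y hy]
    simp [hxx, hyy, hxy, hyfy, hfyx, hx]
    ring
  · have hs := hskew (f x) x (hfG x hx) hx
    simp only [sectional, curvature, haxe x hx, e_nabla_e, nabla_orth x a hx haG,
      nabla_smul, smul_nabla, nabla_e x hx, e_nabla (f x) (hfG x hx)]
    simp [hxx, hunit, hxe x hx, hx, hs]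
    ring
end

section
/- Let (𝔤,⟨·,·⟩) be a metric Lie algebra whose derived algebra is one-dimensional and spanned by a unit vector e, with Γ = e^⊥, a ∈ Γ satisfying [x,e] = ⟨a,x⟩e for all x ∈ Γ, and skew-adjoint f : Γ → Γ satisfying [x,y] = ⟨f(x),y⟩e for all x,y ∈ Γ. Then the curvature tensor R̃ of the tangent algebra T𝔤 satisfies, for all x, y, z ∈ Γ: R̃(x^c,y^c)z^c = (−¼⟨f(y),z⟩f(x) + ¼⟨f(x),z⟩f(y) + ⟨f(x),y⟩(½f(z) + ⟨z,a⟩e))^c; R̃(x^v,y^v)z^v = 0; R̃(x^c,y^v)y^v = (¾⟨f(x),y⟩f(y) + ¾⟨f(x),y⟩⟨a,y⟩e)^c; R̃(x^c,e^v)e^v = (¼⟨f(x),a⟩e − ¼f(f(x)) − ⟨a,x⟩a)^c; R̃(x^v,e^c)e^c = ½⟨f(x),a⟩e^v − ¾⟨a,x⟩a^v; and R̃(x^v,e^v)e^v = (−¼f(f(x)) + ¼⟨a,x⟩a)^v. -/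
/-- The explicit Levi-Civita product of the tangent algebra when every bracket is a multiple of
a fixed vector `e`. -/
theorem tangentLeviCivita_eq_of_bracket_eq_smul
    {G : Type*} [LieRing G] [LieAlgebra ℝ G]
    (inn : G →ₗ[ℝ] G →ₗ[ℝ] ℝ)
    (hpos : ∀ x : G, x ≠ 0 → 0 < inn x x)
    (e : G) (D : G →ₗ[ℝ] G) (hD : ∀ x y : G, ⁅x, y⁆ = inn (D x) y • e)
    (hDskew : ∀ x y : G, inn (D x) y = -inn (D y) x)
    (tnabla : G × G → G × G → G × G)
    (htkoszul : ∀ p q r : G × G,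
      2 * tangentInner inn (tnabla p q) r =
        tangentInner inn (tangentBracket p q) r
          - tangentInner inn (tangentBracket q r) p
          + tangentInner inn (tangentBracket r p) q)
    (p q : G × G) :
    tnabla p q =
      ((1/2 : ℝ) • (inn (D p.1) q.1 • e - inn e p.1 • D q.1 - inn e p.2 • D q.2
          - inn e q.1 • D p.1 - inn e q.2 • D p.2),
        (1/2 : ℝ) • ((inn (D p.1) q.2 + inn (D p.2) q.1) • e - inn e p.2 • D q.1
          - inn e q.2 • D p.1)) := by
  have hnondeg : ∀ x y : G, (∀ z, inn x z = inn y z) → x = y := by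
    intro x y h
    by_contra hxy
    have := hpos (x - y) (sub_ne_zero.mpr hxy)
    rw [map_sub inn, LinearMap.sub_apply, h, sub_self] at this
    exact lt_irrefl 0 this
  ext1 <;> refine hnondeg _ _ fun z => ?_
  · have h := htkoszul p q (z, 0)
    simp only [tangentInner, tangentBracket, hD, map_add, map_sub, map_smul, map_zero,
      LinearMap.add_apply, LinearMap.sub_apply, LinearMap.smul_apply, LinearMap.zero_apply,
      smul_eq_mul] at h ⊢
    rw [hDskew z p.1, hDskew z p.2] at h
    linear_combination (1/2 : ℝ) * h
  · have h := htkoszul p q (0, z)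
    simp only [tangentInner, tangentBracket, hD, map_add, map_sub, map_smul, map_zero,
      LinearMap.add_apply, LinearMap.sub_apply, LinearMap.smul_apply, LinearMap.zero_apply,
      smul_eq_mul] at h ⊢
    rw [hDskew z p.1] at h
    linear_combination (1/2 : ℝ) * h

/-- A Lie algebra with one-dimensional derived algebra spanned by a unit vector `e` has all
brackets of the form `⁅x, y⁆ = ⟨D x, y⟩ e`, for an explicit linear map `D`. -/
theorem exists_linearMap_lie_eq_inner_smul
    {G : Type*} [LieRing G] [LieAlgebra ℝ G]
    (inn : G →ₗ[ℝ] G →ₗ[ℝ] ℝ)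
    (hsymm : ∀ x y : G, inn x y = inn y x)
    (e : G) (hunit : inn e e = 1)
    (a : G) (haG : inn e a = 0)
    (haxe : ∀ x : G, inn e x = 0 → ⁅x, e⁆ = inn a x • e)
    (f : G →ₗ[ℝ] G)
    (hfG : ∀ x : G, inn e x = 0 → inn e (f x) = 0)
    (hfbr : ∀ x y : G, inn e x = 0 → inn e y = 0 → ⁅x, y⁆ = inn (f x) y • e) :
    ∃ D : G →ₗ[ℝ] G, D e = -a ∧ (∀ x : G, inn e x = 0 → D x = f x + inn a x • e) ∧
      ∀ x y : G, ⁅x, y⁆ = inn (D x) y • e := by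
  have hae : inn a e = 0 := by rw [hsymm, haG]
  let D : G →ₗ[ℝ] G := f ∘ₗ (LinearMap.id - (inn e).smulRight e)
    - (inn e).smulRight a + (inn a).smulRight e
  have hDe : D e = -a := by simp [D, hunit, hae]
  have hDx : ∀ x : G, inn e x = 0 → D x = f x + inn a x • e := by
    intro x hx
    simp [D, hx]
  refine ⟨D, hDe, hDx, fun x y => ?_⟩
  have hdecomp : ∀ u : G, ∃ u' : G, ∃ c : ℝ, inn e u' = 0 ∧ u = u' + c • e := fun u =>
    ⟨u - inn e u • e, inn e u, by simp [hunit], by simp⟩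
  obtain ⟨x, α, hx, rfl⟩ := hdecomp x
  obtain ⟨y, β, hy, rfl⟩ := hdecomp y
  have hey : ⁅e, y⁆ = -(inn a y • e) := by rw [← lie_skew, haxe y hy]
  have hfe : inn (f x) e = 0 := by rw [hsymm, hfG x hx]
  simp only [add_lie, lie_add, smul_lie, lie_smul, lie_self, haxe x hx, hey, hfbr x y hx hy,
    map_add, map_smul, map_neg, hDe, hDx x hx, LinearMap.add_apply, LinearMap.smul_apply,
    LinearMap.neg_apply, smul_eq_mul, hunit, hae, hy, hfe]
  module

/-- Let `(𝔤,⟨·,·⟩)` be a metric Lie algebra whose derived algebra is one-dimensional and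
spanned by a unit vector `e`, with `Γ = e^⊥`, `a ∈ Γ` satisfying `[x,e] = ⟨a,x⟩e` for all
`x ∈ Γ`, and skew-adjoint `f : Γ → Γ` satisfying `[x,y] = ⟨f(x),y⟩e` for all `x,y ∈ Γ`.
Then the curvature tensor `R̃` of the tangent algebra `T𝔤` satisfies the stated
formulas. -/
theorem oneDimCommutator_tangent_curvature_formulas
    {G : Type*} [LieRing G] [LieAlgebra ℝ G] [Module.Finite ℝ G]
    (inn : G →ₗ[ℝ] G →ₗ[ℝ] ℝ)
    (hsymm : ∀ x y : G, inn x y = inn y x)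
    (hpos : ∀ x : G, x ≠ 0 → 0 < inn x x)
    (e : G) (hunit : inn e e = 1)
    (hder : Submodule.span ℝ {z : G | ∃ x y : G, ⁅x, y⁆ = z} =
      Submodule.span ℝ ({e} : Set G))
    (a : G) (haG : inn e a = 0)
    (haxe : ∀ x : G, inn e x = 0 → ⁅x, e⁆ = inn a x • e)
    (f : G →ₗ[ℝ] G)
    (hfG : ∀ x : G, inn e x = 0 → inn e (f x) = 0)
    (hskew : ∀ x y : G, inn e x = 0 → inn e y = 0 → inn (f x) y = -inn x (f y))
    (hfbr : ∀ x y : G, inn e x = 0 → inn e y = 0 → ⁅x, y⁆ = inn (f x) y • e)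
    (tnabla : G × G → G × G → G × G)
    (htkoszul : ∀ p q r : G × G,
      2 * tangentInner inn (tnabla p q) r =
        tangentInner inn (tangentBracket p q) r
          - tangentInner inn (tangentBracket q r) p
          + tangentInner inn (tangentBracket r p) q) :
    (∀ x y z : G, inn e x = 0 → inn e y = 0 → inn e z = 0 →
      curvature tangentBracket tnabla (x, 0) (y, 0) (z, 0) =
        ((-(((1/4 : ℝ) * inn (f y) z) • f x) + ((1/4 : ℝ) * inn (f x) z) • f y
            + inn (f x) y • ((1/2 : ℝ) • f z + inn z a • e), 0) : G × G) ∧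
      curvature tangentBracket tnabla (0, x) (0, y) (0, z) = 0) ∧
    (∀ x y : G, inn e x = 0 → inn e y = 0 →
      curvature tangentBracket tnabla (x, 0) (0, y) (0, y) =
        ((((3/4 : ℝ) * inn (f x) y) • f y
            + ((3/4 : ℝ) * inn (f x) y * inn a y) • e, 0) : G × G)) ∧
    (∀ x : G, inn e x = 0 →
      curvature tangentBracket tnabla (x, 0) (0, e) (0, e) =
        ((((1/4 : ℝ) * inn (f x) a) • e - (1/4 : ℝ) • f (f x) - inn a x • a, 0) : G × G) ∧
      curvature tangentBracket tnabla (0, x) (e, 0) (e, 0) =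
        ((0, ((1/2 : ℝ) * inn (f x) a) • e - ((3/4 : ℝ) * inn a x) • a) : G × G) ∧
      curvature tangentBracket tnabla (0, x) (0, e) (0, e) =
        ((0, -((1/4 : ℝ) • f (f x)) + ((1/4 : ℝ) * inn a x) • a) : G × G)) := by
  obtain ⟨D, hDe, hDx, hD⟩ :=
    exists_linearMap_lie_eq_inner_smul inn hsymm e hunit a haG haxe f hfG hfbr
  have hDskew : ∀ x y : G, inn (D x) y = -inn (D y) x := by
    intro x y
    have h := congrArg (inn e) (lie_skew x y)
    simp only [hD, map_neg, map_smul, hunit, smul_eq_mul, mul_one] at h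
    exact h.symm
  have hnab := tangentLeviCivita_eq_of_bracket_eq_smul inn hpos e D hD hDskew
    tnabla htkoszul
  have hxe : ∀ x : G, inn e x = 0 → inn x e = 0 := fun x hx => by rw [hsymm, hx]
  refine ⟨fun x y z hx hy hz => ⟨?_, ?_⟩, fun x y hx hy => ?_, fun x hx => ⟨?_, ?_, ?_⟩⟩
  · ext1
    · simp [curvature, hnab, tangentBracket, hD, hDx, hx, hDe, hfG, hxe, hunit, hy, hz, hsymm z a]
      module
    · simp [curvature, hnab, tangentBracket, hD, hDx, hx, hDe, hfG, hxe, hunit, hy, hz]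
  · ext1 <;> simp [curvature, hnab, tangentBracket, hD, hDx, hx, hy, hz]
  · ext1
    · simp [curvature, hnab, tangentBracket, hD, hDx, hx, hDe, hunit, hy]
      module
    · simp [curvature, hnab, tangentBracket, hD, hDx, hx, hDe, hunit, hy]
  · ext1
    · simp [curvature, hnab, tangentBracket, hD, hDx, hx, hDe, hfG, hxe, hunit, haG, hsymm a (f x)]
      module
    · simp [curvature, hnab, tangentBracket, hD, hDx, hx, hDe, hfG, hxe, hunit, haG]
  · ext1
    · simp [curvature, hnab, tangentBracket, hD, hDx, hx, hDe, hfG, hxe, hunit, haG]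
    · simp [curvature, hnab, tangentBracket, hD, hDx, hx, hDe, hfG, hxe, hunit, haG]
      module
  · ext1
    · simp [curvature, hnab, tangentBracket, hD, hDx, hx, hDe, hfG, hxe, hunit, haG]
    · simp [curvature, hnab, tangentBracket, hD, hDx, hx, hDe, hfG, hxe, hunit, haG, hsymm a (f x)]
      module
end
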